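/- Let p be a prime, m ≥ 1 and n ≥ 1 integers, i : {1,…,n} → {1,…,m} a function, and let N be the set of (m+n)×(m+n) matrices over ℤ/pℤ of block form [[λ·I_m, J],[0, D]], where λ ∈ ℤ/pℤ, D is the n×n diagonal matrix with entries μ₁,…,μₙ, and J is the m×n matrix whose (s, j) entry is ν_j if s = i(j) and 0 otherwise. Then the subset K of N consisting of those matrices with μ₁ = … = μₙ = 0 (i.e., D = 0) is closed under addition, contains 0, and satisfies MX ∈ K and XM ∈ K for all M ∈ N and X ∈ K; moreover K ≠ {0} and K ≠ N. Consequently N is not a simple ring. -/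

import Mathlib

/-- The set of `(m+n) × (m+n)` matrices over `ℤ/pℤ` of block form
`[[λ·I_m, J(ν)], [0, D(μ)]]`, where `J(ν)` has entry `ν j` at position `(i j, j)`
and zeroes elsewhere, and `D(μ)` is the diagonal matrix with entries `μ`. -/
def NSet (p m n : ℕ) (i : Fin n → Fin m) :
    Set (Matrix (Fin m ⊕ Fin n) (Fin m ⊕ Fin n) (ZMod p)) :=
  {M | ∃ (lam : ZMod p) (μ ν : Fin n → ZMod p),
    M = Matrix.fromBlocks (lam • (1 : Matrix (Fin m) (Fin m) (ZMod p)))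
      (Matrix.of fun s j => if s = i j then ν j else 0)
      0 (Matrix.diagonal μ)}

/-- The subset of `NSet` consisting of the matrices with `μ₁ = ⋯ = μₙ = 0`,
i.e. with vanishing lower-right diagonal block. -/
def KSet (p m n : ℕ) (i : Fin n → Fin m) :
    Set (Matrix (Fin m ⊕ Fin n) (Fin m ⊕ Fin n) (ZMod p)) :=
  {M | ∃ (lam : ZMod p) (ν : Fin n → ZMod p),
    M = Matrix.fromBlocks (lam • (1 : Matrix (Fin m) (Fin m) (ZMod p)))
      (Matrix.of fun s j => if s = i j then ν j else 0)
      0 (Matrix.diagonal 0)}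

theorem stmt8 (p : ℕ) (hp : p.Prime) (m n : ℕ) (hm : 1 ≤ m) (hn : 1 ≤ n)
    (i : Fin n → Fin m) :
    KSet p m n i ⊆ NSet p m n i ∧
    (0 : Matrix (Fin m ⊕ Fin n) (Fin m ⊕ Fin n) (ZMod p)) ∈ KSet p m n i ∧
    (∀ X₁ ∈ KSet p m n i, ∀ X₂ ∈ KSet p m n i, X₁ + X₂ ∈ KSet p m n i) ∧
    (∀ M ∈ NSet p m n i, ∀ X ∈ KSet p m n i, M * X ∈ KSet p m n i ∧ X * M ∈ KSet p m n i) ∧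
    KSet p m n i ≠ {0} ∧
    KSet p m n i ≠ NSet p m n i := by
  have : Fact p.Prime := ⟨hp⟩
  refine ⟨?_, ⟨0, 0, ?_⟩, ?_, ?_, ?_, ?_⟩
  · rintro M ⟨lam, ν, rfl⟩
    exact ⟨lam, 0, ν, rfl⟩
  · ext (a | a) (b | b) <;> simp
  · rintro _ ⟨l, ν, rfl⟩ _ ⟨l', ν', rfl⟩
    refine ⟨l + l', ν + ν', ?_⟩
    rw [Matrix.fromBlocks_add, add_smul]
    congr 1
    · ext a b
      by_cases h : a = i b <;> simp [h]
    · simp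
    · simp
  · rintro _ ⟨l, μ, ν, rfl⟩ _ ⟨l', ν', rfl⟩
    refine ⟨⟨l * l', l • ν', ?_⟩, ⟨l' * l, l' • ν + ν' * μ, ?_⟩⟩
    all_goals
      rw [Matrix.fromBlocks_multiply]
      congr 1
      · simp [smul_smul, mul_comm]
      · ext a b
        by_cases h : a = i b <;> simp [h]
      · simp
      · simp
  · intro h
    have hmem : Matrix.fromBlocks ((1 : ZMod p) • (1 : Matrix (Fin m) (Fin m) (ZMod p)))
        (Matrix.of fun s j => if s = i j then (0 : Fin n → ZMod p) j else 0)
        0 (Matrix.diagonal 0) ∈ KSet p m n i := ⟨1, 0, rfl⟩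
    rw [h, Set.mem_singleton_iff] at hmem
    simpa using congrFun (congrFun hmem (Sum.inl ⟨0, hm⟩)) (Sum.inl ⟨0, hm⟩)
  · intro h
    have hmem : Matrix.fromBlocks ((0 : ZMod p) • (1 : Matrix (Fin m) (Fin m) (ZMod p)))
        (Matrix.of fun s j => if s = i j then (0 : Fin n → ZMod p) j else 0)
        0 (Matrix.diagonal 1) ∈ NSet p m n i := ⟨0, 1, 0, rfl⟩
    rw [← h] at hmem
    obtain ⟨l, ν, hM⟩ := hmem
    simpa using congrFun (congrFun hM (Sum.inr ⟨0, hn⟩)) (Sum.inr ⟨0, hn⟩)
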